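/- Let A be a finite alphabet with at least two letters, u ∈ A⁺ a nonempty word, π a permutation of A, w a prefix of Pal(u), and let σ be the w-conjugate of ψ_u ∘ π; assume σ is primitive. Then for every word v ∈ L(σ) and all distinct right return words r ≠ s in R̄(v) (return sets taken in the language L(σ)): (card A − 1)·(|gcp(σ(r)·σ(s), σ(s)·σ(r))| + |w|) ≥ ‖σ‖ − card A, with equality if and only if v is right special in L(σ). -/

import Mathlib

open List

section EpiDefs

variable {A : Type*}

/-- The episturmian generator ψ_a : a ↦ a, b ↦ ab for b ≠ a, as a map on words. -/
def psiL [DecidableEq A] (a : A) : List A → List A :=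
  fun u => (u.map (fun b => if b = a then [a] else [a, b])).flatten

/-- The episturmian generator ψ̄_a : a ↦ a, b ↦ ba for b ≠ a, as a map on words. -/
def psibarL [DecidableEq A] (a : A) : List A → List A :=
  fun u => (u.map (fun b => if b = a then [a] else [b, a])).flatten

/-- ψ_{u₁⋯uₙ} = ψ_{u₁} ∘ ⋯ ∘ ψ_{uₙ}. -/
def psiW [DecidableEq A] (u : List A) : List A → List A :=
  u.foldr (fun a f => psiL a ∘ f) id

/-- ψ̄_{u₁⋯uₙ} = ψ̄_{u₁} ∘ ⋯ ∘ ψ̄_{uₙ}. -/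
def psibarW [DecidableEq A] (u : List A) : List A → List A :=
  u.foldr (fun a f => psibarL a ∘ f) id

/-- There is a shortest palindrome having `x` as a prefix. -/
theorem exists_isPalClosure (x : List A) :
    ∃ p : List A, (p.reverse = p ∧ x <+: p) ∧
      ∀ q : List A, q.reverse = q → x <+: q → p.length ≤ q.length := by
  classical
  have hex : ∃ n : ℕ, ∃ p : List A, (p.reverse = p ∧ x <+: p) ∧ p.length = n :=
    ⟨(x ++ x.reverse).length, x ++ x.reverse, ⟨by simp, ⟨x.reverse, rfl⟩⟩, rfl⟩
  obtain ⟨p, hp, hlen⟩ := Nat.find_spec hex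
  refine ⟨p, hp, fun q h1 h2 => ?_⟩
  rw [hlen]
  exact Nat.find_le ⟨q, ⟨h1, h2⟩, rfl⟩

/-- `palPlus x = x⁽⁺⁾` is the shortest palindrome having `x` as a prefix. -/
noncomputable def palPlus (x : List A) : List A :=
  Classical.choose (exists_isPalClosure x)

/-- Iterated palindromic closure: Pal(ε) = ε, Pal(ua) = (Pal(u)a)⁽⁺⁾. -/
noncomputable def pal (u : List A) : List A :=
  u.foldl (fun p a => palPlus (p ++ [a])) []

/-- Longest common prefix. -/
def gcp [DecidableEq A] : List A → List A → List A
  | a :: x, b :: y => if a = b then a :: gcp x y else []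
  | _, _ => []

/-- Longest common suffix. -/
def gcs [DecidableEq A] (x y : List A) : List A :=
  (gcp x.reverse y.reverse).reverse

/-- The language of a (primitive) substitution: factors of σⁿ(a). -/
def LangS (σ : List A → List A) : Set (List A) :=
  {x | ∃ (n : ℕ) (a : A), x <:+: σ^[n] [a]}

/-- The language of the episturmian shift directed by `d`. -/
def LangD (d : ℕ → A) : Set (List A) :=
  {x | ∃ n : ℕ, x <:+: pal ((List.range n).map d)}

def LeftSpecial (L : Set (List A)) (v : List A) : Prop :=
  ∃ a b : A, a ≠ b ∧ a :: v ∈ L ∧ b :: v ∈ L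

def RightSpecial (L : Set (List A)) (v : List A) : Prop :=
  ∃ a b : A, a ≠ b ∧ v ++ [a] ∈ L ∧ v ++ [b] ∈ L

/-- The left return set of `u` in the language `L`. -/
def leftReturn (L : Set (List A)) (u : List A) : Set (List A) :=
  {r | r ++ u ∈ L ∧ (∃ s : List A, s ≠ [] ∧ r ++ u = u ++ s) ∧
    ¬∃ p q : List A, p ≠ [] ∧ q ≠ [] ∧ r ++ u = p ++ u ++ q}

/-- The right return set of `u` in the language `L`. -/
def rightReturn (L : Set (List A)) (u : List A) : Set (List A) :=
  {r | u ++ r ∈ L ∧ (∃ p : List A, p ≠ [] ∧ u ++ r = p ++ u) ∧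
    ¬∃ p q : List A, p ≠ [] ∧ q ≠ [] ∧ u ++ r = p ++ u ++ q}

/-- `σ` is an endomorphism of the free monoid A*. -/
def IsListHom (σ : List A → List A) : Prop :=
  ∀ x y : List A, σ (x ++ y) = σ x ++ σ y

/-- Primitivity of a substitution. -/
def IsPrimitiveSubst (σ : List A → List A) : Prop :=
  ∃ k : ℕ, 1 ≤ k ∧ ∀ a b : A, b ∈ σ^[k] [a]

/-- At least two distinct letters occur infinitely often in `d`. -/
def NonDegenerate (d : ℕ → A) : Prop :=
  ∃ a b : A, a ≠ b ∧ (∀ N : ℕ, ∃ n : ℕ, N ≤ n ∧ d n = a) ∧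
    (∀ N : ℕ, ∃ n : ℕ, N ≤ n ∧ d n = b)

end EpiDefs

section EpiHelpers

variable {A : Type*}

theorem psiL_nil [DecidableEq A] (c : A) : psiL c [] = [] := rfl

theorem psiL_cons [DecidableEq A] (c b : A) (x : List A) :
    psiL c (b :: x) = (if b = c then [c] else [c, b]) ++ psiL c x := by
  simp [psiL]

theorem psiL_append [DecidableEq A] (c : A) (x y : List A) :
    psiL c (x ++ y) = psiL c x ++ psiL c y := by
  simp [psiL]

theorem psibarL_cons [DecidableEq A] (c b : A) (x : List A) :
    psibarL c (b :: x) = (if b = c then [c] else [b, c]) ++ psibarL c x := by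
  simp [psibarL]

theorem psibarL_append [DecidableEq A] (c : A) (x y : List A) :
    psibarL c (x ++ y) = psibarL c x ++ psibarL c y := by
  simp [psibarL]

theorem psiW_cons [DecidableEq A] (c : A) (u x : List A) :
    psiW (c :: u) x = psiL c (psiW u x) := rfl

theorem psibarW_cons [DecidableEq A] (c : A) (u x : List A) :
    psibarW (c :: u) x = psibarL c (psibarW u x) := rfl

theorem psiW_append [DecidableEq A] (u x y : List A) :
    psiW u (x ++ y) = psiW u x ++ psiW u y := by
  induction u with
  | nil => rfl
  | cons c u ih => simp [psiW_cons, ih, psiL_append]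

theorem psiW_nil [DecidableEq A] (u : List A) : psiW u [] = [] := by
  induction u with
  | nil => rfl
  | cons c u ih => simp [psiW_cons, ih, psiL_nil]

/-- Recursive description of the iterated palindromic closure. -/
def PP [DecidableEq A] : List A → List A
  | [] => []
  | c :: u => psiL c (PP u) ++ [c]

theorem psiL_comm [DecidableEq A] (c : A) (x : List A) :
    psiL c x ++ [c] = [c] ++ psibarL c x := by
  induction x with
  | nil => simp [psiL, psibarL]
  | cons b x ih =>
    rw [psiL_cons, psibarL_cons, List.append_assoc, ih]
    by_cases h : b = c <;> simp [h]

theorem psiW_PP [DecidableEq A] (u x : List A) :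
    psiW u x ++ PP u = PP u ++ psibarW u x := by
  induction u with
  | nil => simp [PP, psiW, psibarW]
  | cons c u ih =>
    rw [psiW_cons, psibarW_cons, PP, ← List.append_assoc, ← psiL_append, ih, psiL_append,
      List.append_assoc, psiL_comm, List.append_assoc]

theorem psibarW_head [DecidableEq A] (u : List A) (a : A) (x : List A) :
    ∃ t, psibarW u (a :: x) = a :: t := by
  induction u with
  | nil => exact ⟨x, rfl⟩
  | cons c u ih =>
    obtain ⟨t, ht⟩ := ih
    rw [psibarW_cons, ht, psibarL_cons]
    by_cases h : a = c
    · exact ⟨psibarL c t, by simp [h]⟩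
    · exact ⟨c :: psibarL c t, by simp [h]⟩

theorem psiW_PP_head [DecidableEq A] (u : List A) (a : A) (x : List A) :
    ∃ t, psiW u (a :: x) ++ PP u = PP u ++ a :: t := by
  obtain ⟨t, ht⟩ := psibarW_head u a x
  exact ⟨t, by rw [psiW_PP, ht]⟩

theorem psiW_concat [DecidableEq A] (u : List A) (c : A) (x : List A) :
    psiW (u ++ [c]) x = psiW u (psiL c x) := by
  induction u with
  | nil => rfl
  | cons d u ih => rw [List.cons_append, psiW_cons, ih, psiW_cons]

theorem PP_concat [DecidableEq A] (u : List A) (c : A) :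
    PP (u ++ [c]) = psiW u [c] ++ PP u := by
  induction u with
  | nil => simp [PP, psiW, psiL]
  | cons d u ih => rw [List.cons_append, PP, ih, psiL_append, psiW_cons, PP, List.append_assoc]

theorem length_psiL [DecidableEq A] (c : A) (x : List A) : x.length ≤ (psiL c x).length := by
  induction x with
  | nil => simp
  | cons b x ih =>
    rw [psiL_cons]
    by_cases h : b = c <;> simp [h] <;> omega

theorem length_psiW [DecidableEq A] (u x : List A) : x.length ≤ (psiW u x).length := by
  induction u with
  | nil => exact le_rfl
  | cons c u ih => exact ih.trans (length_psiL c _)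

theorem length_psiW_concat [DecidableEq A] (u : List A) (c a : A) :
    (psiW (u ++ [c]) [a]).length =
      (if a = c then 0 else (psiW u [c]).length) + (psiW u [a]).length := by
  rw [psiW_concat, psiL_cons, psiL_nil, List.append_nil]
  by_cases h : a = c
  · simp [h]
  · have : [c, a] = [c] ++ [a] := rfl
    simp only [h, if_false, this, psiW_append, List.length_append]

theorem sum_length_psiW [Fintype A] [DecidableEq A] (u : List A) (hA : 1 ≤ Fintype.card A) :
    ∑ a : A, (psiW u [a]).length =
      (Fintype.card A - 1) * (PP u).length + Fintype.card A := by
  induction u using List.reverseRecOn with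
  | nil => simp [psiW, PP]
  | append_singleton u c ih =>
    simp only [length_psiW_concat, Finset.sum_add_distrib, ih, PP_concat, List.length_append]
    have : ∑ x : A, (if x = c then 0 else (psiW u [c]).length)
        = (Fintype.card A - 1) * (psiW u [c]).length := by
      rw [Finset.sum_ite]
      simp [Finset.filter_ne', Finset.card_univ]
    rw [this]; ring

theorem pair_length [DecidableEq A] (u : List A) {a b : A} (hab : a ≠ b) :
    (PP u).length + 2 ≤ (psiW u [a]).length + (psiW u [b]).length := by
  induction u using List.reverseRecOn with
  | nil => simp [psiW, PP]
  | append_singleton u c ih =>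
    have h1 := length_psiW u [a]
    have h2 := length_psiW u [b]
    simp only [List.length_singleton] at h1 h2
    rw [length_psiW_concat, length_psiW_concat, PP_concat, List.length_append]
    by_cases ha : a = c
    · have hb : b ≠ c := fun h => hab (ha.trans h.symm)
      subst ha
      simp only [hb, if_false, if_true]; omega
    · by_cases hb : b = c
      · subst hb
        simp only [ha, if_false, if_true]; omega
      · simp only [ha, hb, if_false]
        have := length_psiW u [c]
        omega

theorem gcp_append [DecidableEq A] (p x y : List A) :
    gcp (p ++ x) (p ++ y) = p ++ gcp x y := by
  induction p with
  | nil => rfl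
  | cons a p ih => simp [gcp, ih]

theorem gcp_split [DecidableEq A] (p x y : List A) {a b : A} (h : a ≠ b) :
    gcp (p ++ a :: x) (p ++ b :: y) = p := by
  rw [gcp_append]; simp [gcp, h]

theorem prefix_of_split {w q x y : List A} {a b : A} (hab : a ≠ b)
    (h1 : w <+: q ++ a :: x) (h2 : w <+: q ++ b :: y) : w <+: q := by
  induction q generalizing w with
  | nil =>
    cases w with
    | nil => simp
    | cons c w =>
      simp only [List.nil_append, List.cons_prefix_cons] at h1 h2
      exact absurd (h1.1.symm.trans h2.1) hab
  | cons d q ih =>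
    cases w with
    | nil => simp
    | cons c w =>
      simp only [List.cons_append, List.cons_prefix_cons] at h1 h2 ⊢
      exact ⟨h1.1, ih h1.2 h2.2⟩

theorem prefix_long {m q x : List A} {a : A} (h : m <+: q ++ a :: x)
    (hl : q.length < m.length) : ∃ t, m = q ++ a :: t := by
  have h2 : q ++ [a] <+: q ++ a :: x := ⟨x, by simp⟩
  obtain ⟨t, ht⟩ := List.prefix_of_prefix_length_le h2 h (by simp; omega)
  exact ⟨t, by rw [← ht]; simp⟩

theorem split_of_not_prefix {x y : List A} (h1 : ¬ x <+: y) (h2 : ¬ y <+: x) :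
    ∃ p a b x' y', a ≠ b ∧ x = p ++ a :: x' ∧ y = p ++ b :: y' := by
  induction x generalizing y with
  | nil => exact absurd List.nil_prefix h1
  | cons a x ih =>
    cases y with
    | nil => exact absurd List.nil_prefix h2
    | cons b y =>
      by_cases hab : a = b
      · subst hab
        simp only [List.cons_prefix_cons, true_and] at h1 h2
        obtain ⟨p, c, d, x', y', h, hx, hy⟩ := ih h1 h2
        exact ⟨a :: p, c, d, x', y', h, by simp [hx], by simp [hy]⟩
      · exact ⟨[], a, b, x, y, hab, rfl, rfl⟩

theorem split_of_not_suffix {x y : List A} (h1 : ¬ x <:+ y) (h2 : ¬ y <:+ x) :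
    ∃ z a b, a ≠ b ∧ a :: z <:+ x ∧ b :: z <:+ y := by
  rw [← List.reverse_prefix] at h1 h2
  obtain ⟨p, a, b, x', y', h, hx, hy⟩ := split_of_not_prefix h1 h2
  refine ⟨p.reverse, a, b, h, ?_, ?_⟩
  · rw [← List.reverse_prefix, hx]
    exact ⟨x', by simp⟩
  · rw [← List.reverse_prefix, hy]
    exact ⟨y', by simp⟩


theorem psiL_head [DecidableEq A] {c a : A} {m q : List A} (h : psiL c m = a :: q) : a = c := by
  cases m with
  | nil => simp [psiL] at h
  | cons b m =>
    rw [psiL_cons] at h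
    by_cases hb : b = c <;> simp [hb] at h <;> exact h.1.symm

theorem psiL_then_head [DecidableEq A] (c : A) (z t : List A) :
    ∃ s, psiL c z ++ c :: t = c :: s := by
  cases z with
  | nil => exact ⟨t, rfl⟩
  | cons b z =>
    rw [psiL_cons]
    by_cases hb : b = c <;> simp [hb]

theorem desub_right [DecidableEq A] {c a : A} {z q m : List A}
    (h : psiL c z ++ c :: a :: q = psiL c m) : z ++ [a] <+: m := by
  induction z generalizing m with
  | nil =>
    cases m with
    | nil => simp [psiL] at h
    | cons m0 m =>
      rw [psiL_cons, psiL_nil] at h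
      by_cases h0 : m0 = c
      · simp [h0] at h
        have := psiL_head h.symm
        simp [h0, this]
      · simp [h0] at h
        simp [h.1]
  | cons y z ih =>
    obtain ⟨s, hs⟩ := psiL_then_head c z (a :: q)
    cases m with
    | nil => 
      have := congrArg List.length h
      simp [psiL_nil] at this
    | cons m0 m =>
      rw [psiL_cons, psiL_cons] at h
      by_cases hy : y = c <;> by_cases h0 : m0 = c
      · simp [hy, h0] at h
        simpa [hy, h0] using ih h
      · simp [hy, h0, hs] at h
        exact absurd h.1.symm h0
      · simp [hy, h0] at h
        exact absurd (psiL_head h.symm) hy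
      · simp [hy, h0] at h
        simpa [h.1] using ih h.2

theorem desub_left [DecidableEq A] {c c1 : A} {p t m : List A}
    (h : p ++ c1 :: c :: t = psiL c m) :
    ∃ m1 m2, m = m1 ++ c1 :: m2 ∧ psiL c m2 = c :: t := by
  induction m generalizing p with
  | nil => simp [psiL] at h
  | cons m0 m ih =>
    rw [psiL_cons] at h
    by_cases h0 : m0 = c
    · cases p with
      | nil =>
        simp [h0] at h
        exact ⟨[], m, by simp [h.1, h0], h.2.symm⟩
      | cons p0 p =>
        simp [h0] at h
        obtain ⟨m1, m2, h1, h2⟩ := ih h.2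
        exact ⟨m0 :: m1, m2, by simp [h1], h2⟩
    · match p, h with
      | [], h =>
        simp [h0] at h
        exact absurd h.2.1.symm h0
      | [x], h =>
        simp [h0] at h
        exact ⟨[], m, by simp [h.2.1], h.2.2.symm⟩
      | x :: y :: p, h =>
        simp [h0] at h
        obtain ⟨m1, m2, h1, h2⟩ := ih h.2.2
        exact ⟨m0 :: m1, m2, by simp [h1], h2⟩

theorem desub [DecidableEq A] {c c1 a : A} {z m : List A}
    (h : c1 :: ((psiL c z ++ [c]) ++ [a]) <:+: psiL c m) : c1 :: (z ++ [a]) <:+: m := by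
  obtain ⟨p, q, h⟩ := h
  obtain ⟨s, hs⟩ := psiL_then_head c z (a :: q)
  have h' : p ++ c1 :: c :: s = psiL c m := by
    rw [← hs, ← h]; simp
  obtain ⟨m1, m2, h1, h2⟩ := desub_left h'
  rw [← hs] at h2
  obtain ⟨t, ht⟩ := desub_right h2.symm
  exact ⟨m1, t, by rw [h1, ← ht]; simp⟩

theorem psiL_chain [DecidableEq A] (c : A) (m : List A) :
    List.IsChain (fun x y => x = c ∨ y = c) (psiL c m) := by
  induction m with
  | nil => simp [psiL]
  | cons b m ih =>
    rw [psiL_cons]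
    rcases hm : psiL c m with _ | ⟨d, t⟩
    · by_cases hb : b = c <;> simp [hb]
    · have hd := psiL_head hm
      rw [hm] at ih
      by_cases hb : b = c <;> simp [hb, hd] <;> simpa [hd] using ih

theorem chain_struct [DecidableEq A] {c a : A} (ha : a ≠ c) : ∀ (n : ℕ) (t : List A),
    t.length ≤ n → List.IsChain (fun x y => x = c ∨ y = c) (c :: (t ++ [a])) →
    ∃ z, c :: t = psiL c z ++ [c] := by
  intro n
  induction n with
  | zero =>
    intro t ht _
    have : t = [] := List.length_eq_zero_iff.mp (by omega)
    exact ⟨[], by simp [this, psiL]⟩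
  | succ n ih =>
    intro t ht h
    match t, ht, h with
    | [], _, _ => exact ⟨[], by simp [psiL]⟩
    | d :: t, ht, h =>
      by_cases hd : d = c
      · subst hd
        simp only [List.length_cons] at ht
        simp only [List.cons_append, List.isChain_cons_cons] at h
        obtain ⟨z, hz⟩ := ih t (by omega) h.2
        exact ⟨d :: z, by rw [psiL_cons, hz]; simp⟩
      · match t, ht, h with
        | [], _, h => simp [hd, ha] at h
        | x :: t, ht, h =>
          simp only [List.length_cons] at ht
          simp only [List.cons_append, List.isChain_cons_cons] at h
          have hx : x = c := h.2.1.resolve_left hd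
          subst hx
          obtain ⟨z, hz⟩ := ih t (by omega) h.2.2
          exact ⟨d :: z, by rw [psiL_cons, hz]; simp [hd]⟩

/-- A configuration of two right special words with longest common suffix `z`. -/
def BadConf (P : List A → Prop) (z : List A) : Prop :=
  ∃ c d a b e f, c ≠ d ∧ a ≠ b ∧ e ≠ f ∧ P (c :: (z ++ [a])) ∧ P (c :: (z ++ [b])) ∧
    P (d :: (z ++ [e])) ∧ P (d :: (z ++ [f]))

theorem struct_aux [DecidableEq A] {c c1 a b : A} {z : List A} (hc : c1 ≠ c) (hab : a ≠ b)
    (h1 : List.IsChain (fun x y => x = c ∨ y = c) (c1 :: (z ++ [a])))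
    (h2 : List.IsChain (fun x y => x = c ∨ y = c) (c1 :: (z ++ [b]))) :
    ∃ z', z = psiL c z' ++ [c] := by
  cases z with
  | nil =>
    simp [hc] at h1 h2
    exact absurd (h1.trans h2.symm) hab
  | cons x t =>
    simp only [List.cons_append, List.isChain_cons_cons] at h1 h2
    have hx : x = c := h1.1.resolve_left hc
    subst hx
    by_cases ha : a = x
    · exact chain_struct (fun hb => hab (ha.trans hb.symm)) _ t le_rfl h2.2
    · exact chain_struct ha _ t le_rfl h1.2

theorem bad_step [DecidableEq A] (S : Set (List A)) (c : A) (z : List A)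
    (h : BadConf (fun x => ∃ y ∈ S, x <:+: psiL c y) z) :
    ∃ z', z'.length < z.length ∧ BadConf (fun x => ∃ y ∈ S, x <:+: y) z' := by
  obtain ⟨c1, c2, a, b, e, f, hc, hab, hef, ⟨y1, s1, h1⟩, ⟨y2, s2, h2⟩, ⟨y3, s3, h3⟩,
    ⟨y4, s4, h4⟩⟩ := h
  have key : ∃ z', z = psiL c z' ++ [c] := by
    by_cases hc1 : c1 = c
    · exact struct_aux (fun h => hc (hc1.trans h.symm)) hef
        ((psiL_chain c y3).infix h3) ((psiL_chain c y4).infix h4)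
    · exact struct_aux hc1 hab
        ((psiL_chain c y1).infix h1) ((psiL_chain c y2).infix h2)
  obtain ⟨z', rfl⟩ := key
  refine ⟨z', ?_, c1, c2, a, b, e, f, hc, hab, hef, ⟨y1, s1, desub h1⟩, ⟨y2, s2, desub h2⟩,
    ⟨y3, s3, desub h3⟩, ⟨y4, s4, desub h4⟩⟩
  have := length_psiL c z'
  simp; omega

theorem bad_steps [DecidableEq A] (S : Set (List A)) (u : List A) (z : List A)
    (h : BadConf (fun x => ∃ y ∈ S, x <:+: psiW u y) z) :
    ∃ z', z'.length + u.length ≤ z.length ∧ BadConf (fun x => ∃ y ∈ S, x <:+: y) z' := by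
  induction u generalizing z with
  | nil => exact ⟨z, by simp, h⟩
  | cons c u ih =>
    have h' : BadConf (fun x => ∃ y ∈ psiW u '' S, x <:+: psiL c y) z := by
      simpa [BadConf, psiW_cons] using h
    obtain ⟨z1, hl, h1⟩ := bad_step _ c z h'
    have h1' : BadConf (fun x => ∃ y ∈ S, x <:+: psiW u y) z1 := by
      simpa [BadConf] using h1
    obtain ⟨z2, hl2, h2⟩ := ih z1 h1'
    exact ⟨z2, by simp; omega, h2⟩

theorem no_bad [DecidableEq A] (L : Set (List A)) (hL : ∀ x y, x <:+: y → y ∈ L → x ∈ L)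
    (u : List A) (hu : u ≠ []) (π : Equiv.Perm A)
    (hsub : ∀ x ∈ L, ∃ y ∈ L, x <:+: psiW u (y.map π)) :
    ∀ (n : ℕ) (z : List A), z.length ≤ n → ¬ BadConf (fun x => x ∈ L) z := by
  have hpos : 0 < u.length := List.length_pos_iff.mpr hu
  have main : ∀ z, BadConf (fun x => x ∈ L) z →
      ∃ z', z'.length < z.length ∧ BadConf (fun x => x ∈ L) z' := by
    intro z h
    have h' : BadConf (fun x => ∃ y ∈ (List.map π) '' L, x <:+: psiW u y) z := by
      obtain ⟨c1, c2, a, b, e, f, hc, hab, hef, h1, h2, h3, h4⟩ := h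
      refine ⟨c1, c2, a, b, e, f, hc, hab, hef, ?_, ?_, ?_, ?_⟩
      · simpa using hsub _ h1
      · simpa using hsub _ h2
      · simpa using hsub _ h3
      · simpa using hsub _ h4
    obtain ⟨z', hl, hz'⟩ := bad_steps _ u z h'
    have conv : ∀ x, (∃ y ∈ (List.map π) '' L, x <:+: y) → x.map π.symm ∈ L := by
      rintro x ⟨_, ⟨y, hy, rfl⟩, hx⟩
      have h := hx.map π.symm
      rw [List.map_map] at h
      simp only [Equiv.symm_comp_self, List.map_id] at h
      exact hL _ _ h hy
    obtain ⟨c1, c2, a, b, e, f, hc, hab, hef, h1, h2, h3, h4⟩ := hz'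
    refine ⟨z'.map π.symm, by simp; omega, π.symm c1, π.symm c2, π.symm a, π.symm b, π.symm e,
      π.symm f, by simpa, by simpa, by simpa, ?_, ?_, ?_, ?_⟩
    · simpa using conv _ h1
    · simpa using conv _ h2
    · simpa using conv _ h3
    · simpa using conv _ h4
  intro n
  induction n with
  | zero =>
    intro z hz h
    obtain ⟨z', hl, _⟩ := main z h
    omega
  | succ n ih =>
    intro z hz h
    obtain ⟨z', hl, h'⟩ := main z h
    exact ih z' (by omega) h'


theorem langS_infix (σ : List A → List A) {x y : List A} (h : x <:+: y) (hy : y ∈ LangS σ) :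
    x ∈ LangS σ := by
  obtain ⟨n, a, h'⟩ := hy
  exact ⟨n, a, h.trans h'⟩

theorem hom_nil {σ : List A → List A} (hσ : IsListHom σ) : σ [] = [] := by
  have := congrArg List.length (hσ [] [])
  simp at this
  exact this

theorem hom_iterate {σ : List A → List A} (hσ : IsListHom σ) (n : ℕ) : IsListHom (σ^[n]) := by
  induction n with
  | zero => intro x y; rfl
  | succ n ih => intro x y; simp only [Function.iterate_succ', Function.comp, ih x y, hσ _ _]

theorem hom_infix {σ : List A → List A} (hσ : IsListHom σ) {x y : List A} (h : x <:+: y) :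
    σ x <:+: σ y := by
  obtain ⟨p, q, rfl⟩ := h
  exact ⟨σ p, σ q, by rw [hσ, hσ]⟩

theorem langS_map {σ : List A → List A} (hσ : IsListHom σ) (n : ℕ) {x : List A}
    (hx : x ∈ LangS σ) : σ^[n] x ∈ LangS σ := by
  obtain ⟨m, a, h⟩ := hx
  refine ⟨n + m, a, ?_⟩
  rw [Function.iterate_add_apply]
  exact hom_infix (hom_iterate hσ n) h

theorem hom_length {σ : List A → List A} (hσ : IsListHom σ)
    (hne : ∀ a, 1 ≤ (σ [a]).length) (x : List A) : x.length ≤ (σ x).length := by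
  induction x with
  | nil => simp
  | cons a x ih =>
    have : a :: x = [a] ++ x := rfl
    rw [this, hσ]
    have := hne a
    simp; omega

theorem iterate_length {σ : List A → List A} (hσ : IsListHom σ)
    (hne : ∀ a, 1 ≤ (σ [a]).length) (n : ℕ) (x : List A) : x.length ≤ (σ^[n] x).length := by
  induction n with
  | zero => exact le_rfl
  | succ n ih =>
    rw [Function.iterate_succ_apply']
    exact ih.trans (hom_length hσ hne _)

theorem langS_ext [Fintype A] (hA : 1 < Fintype.card A)
    {σ : List A → List A} (hσ : IsListHom σ)
    (hne : ∀ a, 1 ≤ (σ [a]).length) (hprim : IsPrimitiveSubst σ) (x : List A)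
    (hx : x ∈ LangS σ) : ∃ e, x ++ [e] ∈ LangS σ := by
  obtain ⟨k, hk, hp⟩ := hprim
  obtain ⟨a0, b0, hab⟩ := Fintype.one_lt_card_iff.mp hA
  -- a two-letter word in the language
  have h2 : ∃ c d, [c, d] ∈ LangS σ := by
    have ha := hp a0 a0
    have hb := hp a0 b0
    rcases hm : σ^[k] [a0] with _ | ⟨c, _ | ⟨d, t⟩⟩
    · rw [hm] at ha; simp at ha
    · rw [hm] at ha hb; simp at ha hb; exact absurd (ha.trans hb.symm) hab
    · exact ⟨c, d, k, a0, by rw [hm]; exact ⟨[], t, by simp⟩⟩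
  obtain ⟨c, d, hcd⟩ := h2
  obtain ⟨n, a, hxa⟩ := hx
  have hcdk := langS_map hσ k hcd
  have : [c, d] = [c] ++ [d] := rfl
  rw [this, hom_iterate hσ k] at hcdk
  obtain ⟨p, q, hpq⟩ := List.append_of_mem (hp c a)
  have hdne : q ++ σ^[k] [d] ≠ [] := by
    have := List.ne_nil_of_mem (hp d a)
    simp [this]
  obtain ⟨b, t, hbt⟩ := List.exists_cons_of_ne_nil hdne
  have hab' : [a] ++ [b] ∈ LangS σ := by
    refine langS_infix σ ⟨p, t, ?_⟩ hcdk
    rw [hpq]; simp [hbt]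
  have hf := langS_map hσ n hab'
  rw [hom_iterate hσ n] at hf
  obtain ⟨p', q', hpq'⟩ := hxa
  have hbn : q' ++ σ^[n] [b] ≠ [] := by
    have := iterate_length hσ hne n [b]
    intro h
    simp at h
    simp [h.2] at this
  obtain ⟨e, t', ht'⟩ := List.exists_cons_of_ne_nil hbn
  refine ⟨e, langS_infix σ ⟨p', t', ?_⟩ hf⟩
  rw [← hpq', List.append_assoc _ q', ht']; simp

theorem langS_ext_long [Fintype A] (hA : 1 < Fintype.card A)
    {σ : List A → List A} (hσ : IsListHom σ)
    (hne : ∀ a, 1 ≤ (σ [a]).length) (hprim : IsPrimitiveSubst σ) (x : List A)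
    (hx : x ∈ LangS σ) (n : ℕ) : ∃ t, t.length = n ∧ x ++ t ∈ LangS σ := by
  induction n with
  | zero => exact ⟨[], rfl, by simpa⟩
  | succ n ih =>
    obtain ⟨t, ht, h⟩ := ih
    obtain ⟨e, he⟩ := langS_ext hA hσ hne hprim _ h
    exact ⟨t ++ [e], by simp [ht], by simpa using he⟩

theorem langS_preimage [Fintype A] (hA : 1 < Fintype.card A)
    {σ : List A → List A} (hσ : IsListHom σ)
    (hprim : IsPrimitiveSubst σ) (x : List A)
    (hx : x ∈ LangS σ) : ∃ y ∈ LangS σ, x <:+: σ y := by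
  obtain ⟨k, hk, hp⟩ := hprim
  obtain ⟨n, a, hxa⟩ := hx
  obtain ⟨p, q, hpq⟩ := List.append_of_mem (hp a a)
  have h1 : [a] <:+: σ^[k] [a] := ⟨p, q, by rw [hpq]; simp⟩
  have h2 := hom_infix (hom_iterate hσ n) h1
  rw [← Function.iterate_add_apply] at h2
  obtain ⟨m, hm⟩ : ∃ m, n + k = m + 1 := ⟨n + k - 1, by omega⟩
  rw [hm, Function.iterate_succ_apply'] at h2
  exact ⟨σ^[m] [a], ⟨m, a, List.infix_refl _⟩, hxa.trans h2⟩

theorem conj_all [DecidableEq A] (u : List A) (π : Equiv.Perm A) (w : List A)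
    {σ : List A → List A} (hσhom : IsListHom σ)
    (hσ : ∀ a : A, psiW u [π a] ++ w = w ++ σ [a]) (x : List A) :
    psiW u (x.map π) ++ w = w ++ σ x := by
  induction x with
  | nil => simp [psiW_nil, hom_nil hσhom]
  | cons a x ih =>
    have h1 : (a :: x).map π = [π a] ++ x.map π := rfl
    have h2 : a :: x = [a] ++ x := rfl
    rw [h1, psiW_append, List.append_assoc, ih, ← List.append_assoc, hσ, h2, hσhom,
      List.append_assoc]

theorem langS_sub [Fintype A] [DecidableEq A] (hA : 1 < Fintype.card A)
    (u : List A) (π : Equiv.Perm A) (w : List A)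
    {σ : List A → List A} (hσhom : IsListHom σ)
    (hσ : ∀ a : A, psiW u [π a] ++ w = w ++ σ [a])
    (hne : ∀ a, 1 ≤ (σ [a]).length) (hprim : IsPrimitiveSubst σ) (x : List A)
    (hx : x ∈ LangS σ) : ∃ y ∈ LangS σ, x <:+: psiW u (y.map π) := by
  obtain ⟨y, hy, hxy⟩ := langS_preimage hA hσhom hprim x hx
  obtain ⟨t, ht, hyt⟩ := langS_ext_long hA hσhom hne hprim y hy w.length
  refine ⟨y ++ t, hyt, hxy.trans ?_⟩
  have h := conj_all u π w hσhom hσ (y ++ t)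
  rw [hσhom, ← List.append_assoc w] at h
  have hl := congrArg List.length h
  have hl2 := hom_length hσhom hne t
  simp only [List.length_append] at hl
  have hp1 : w ++ σ y <+: psiW u ((y ++ t).map π) ++ w := ⟨σ t, h.symm⟩
  have hp2 : psiW u ((y ++ t).map π) <+: psiW u ((y ++ t).map π) ++ w := ⟨w, rfl⟩
  have hp := List.prefix_of_prefix_length_le hp1 hp2 (by simp only [List.length_append]; omega)
  exact (List.suffix_append w (σ y)).isInfix.trans hp.isInfix

theorem conj_prefix [Fintype A] [DecidableEq A] (hA : 1 < Fintype.card A)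
    (u : List A) (π : Equiv.Perm A) (w : List A)
    {σ : List A → List A} (hσhom : IsListHom σ)
    (hσ : ∀ a : A, psiW u [π a] ++ w = w ++ σ [a]) : w <+: PP u := by
  have key : ∀ a : A, ∃ t, w <+: PP u ++ π a :: t := by
    intro a
    have h := conj_all u π w hσhom hσ (List.replicate (w.length + 1) a)
    have hp1 : w <+: psiW u ((List.replicate (w.length + 1) a).map π) ++ w := ⟨_, h.symm⟩
    have hl := length_psiW u ((List.replicate (w.length + 1) a).map π)
    simp only [List.length_map, List.length_replicate] at hl
    have hp := List.prefix_of_prefix_length_le hp1 (List.prefix_append _ w) (by omega)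
    obtain ⟨t, ht⟩ := psiW_PP_head u (π a) ((List.replicate w.length a).map π)
    refine ⟨t, ?_⟩
    rw [← ht]
    exact hp.trans (List.prefix_append _ _)
  obtain ⟨a, b, hab⟩ := Fintype.one_lt_card_iff.mp hA
  obtain ⟨t, ht⟩ := key a
  obtain ⟨t', ht'⟩ := key b
  exact prefix_of_split (fun h => hab (π.injective h)) ht ht'

theorem return_not_prefix {L : Set (List A)} {v r s : List A}
    (hr : r ∈ rightReturn L v) (hs : s ∈ rightReturn L v) (hrs : r ≠ s) : ¬ r <+: s := by
  rintro ⟨t, rfl⟩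
  obtain ⟨_, ⟨p, hp, hpv⟩, _⟩ := hr
  refine hs.2.2 ⟨p, t, hp, ?_, ?_⟩
  · rintro rfl; simp at hrs
  · rw [← List.append_assoc, hpv]

end EpiHelpers

/-- for distinct right return words r ≠ s to v,
`(|A|-1)·(|gcp(σ(r)σ(s), σ(s)σ(r))| + |w|) ≥ ‖σ‖ - |A|`, with equality iff v is
right special. -/
theorem gcp_image_return_words_ge_coindex {A : Type*} [Fintype A] [DecidableEq A]
    (hA : 1 < Fintype.card A) (u : List A) (hu : u ≠ []) (π : Equiv.Perm A)
    (w : List A) (hw : w <+: pal u)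
    (σ : List A → List A) (hσhom : IsListHom σ)
    (hσ : ∀ a : A, psiW u [π a] ++ w = w ++ σ [a])
    (hprim : IsPrimitiveSubst σ)
    (v : List A) (hv : v ∈ LangS σ)
    (r s : List A) (hr : r ∈ rightReturn (LangS σ) v) (hs : s ∈ rightReturn (LangS σ) v)
    (hrs : r ≠ s) :
    (∑ a : A, (σ [a]).length) - Fintype.card A ≤
      (Fintype.card A - 1) * ((gcp (σ r ++ σ s) (σ s ++ σ r)).length + w.length) ∧
    ((Fintype.card A - 1) * ((gcp (σ r ++ σ s) (σ s ++ σ r)).length + w.length) =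
        (∑ a : A, (σ [a]).length) - Fintype.card A ↔
      RightSpecial (LangS σ) v) := by
  have hlen : ∀ a, (σ [a]).length = (psiW u [π a]).length := by
    intro a
    have := congrArg List.length (hσ a)
    simp only [List.length_append] at this
    omega
  have hne : ∀ a, 1 ≤ (σ [a]).length := by
    intro a
    rw [hlen]
    exact length_psiW u [π a]
  have hsum : ∑ a : A, (σ [a]).length - Fintype.card A = (Fintype.card A - 1) * (PP u).length := by
    have h1 : ∑ a : A, (σ [a]).length = ∑ a : A, (psiW u [a]).length := by
      simp only [hlen]
      exact Equiv.sum_comp π (fun a => (psiW u [a]).length)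
    rw [h1, sum_length_psiW u hA.le]
    omega
  have hwP := conj_prefix hA u π w hσhom hσ
  obtain ⟨p, a, b, r', s', hab, hrp, hsp⟩ :=
    split_of_not_prefix (return_not_prefix hr hs hrs) (return_not_prefix hs hr hrs.symm)
  have hπ : π a ≠ π b := fun h => hab (π.injective h)
  have key : ∀ (c d : A) (x y : List A), c ≠ d → 
      ∃ t, w ++ σ (p ++ c :: (x ++ d :: y)) = (psiW u (p.map π) ++ PP u) ++ π c :: t := by
    intro c d x y hcd
    have h := conj_all u π w hσhom hσ (p ++ c :: (x ++ d :: y))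
    obtain ⟨t, ht⟩ := psiW_PP_head u (π c) ((x ++ d :: y).map π)
    have hfull : psiW u ((p ++ c :: (x ++ d :: y)).map π) ++ PP u
        = (psiW u (p.map π) ++ PP u) ++ π c :: t := by
      rw [List.map_append, psiW_append, List.append_assoc, List.map_cons, ht, List.append_assoc]
    rw [← h]
    refine prefix_long (x := t) ?_ ?_
    · rw [← hfull]
      exact (List.prefix_append_right_inj _).mpr hwP
    · have e : (p ++ c :: (x ++ d :: y)).map π
          = p.map π ++ ([π c] ++ (x.map π ++ ([π d] ++ y.map π))) := by simp
      rw [e]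
      simp only [psiW_append, List.length_append]
      have := pair_length u (fun h => hcd (π.injective h) : π c ≠ π d)
      omega
  have hg : (gcp (σ r ++ σ s) (σ s ++ σ r)).length + w.length
      = (psiW u (p.map π)).length + (PP u).length := by
    obtain ⟨t1, ht1⟩ := key a b (r' ++ p) s' hab
    obtain ⟨t2, ht2⟩ := key b a (s' ++ p) r' hab.symm
    have e1 : p ++ a :: ((r' ++ p) ++ b :: s') = r ++ s := by rw [hrp, hsp]; simp
    have e2 : p ++ b :: ((s' ++ p) ++ a :: r') = s ++ r := by rw [hrp, hsp]; simp
    rw [e1, hσhom] at ht1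
    rw [e2, hσhom] at ht2
    have h3 := gcp_append w (σ r ++ σ s) (σ s ++ σ r)
    rw [ht1, ht2, gcp_split _ _ _ hπ] at h3
    have := congrArg List.length h3
    simp only [List.length_append] at this
    omega
  have hiff : p = [] ↔ RightSpecial (LangS σ) v := by
    constructor
    · rintro rfl
      refine ⟨a, b, hab, langS_infix σ ?_ hr.1, langS_infix σ ?_ hs.1⟩
      · rw [hrp]; exact ⟨[], r', by simp⟩
      · rw [hsp]; exact ⟨[], s', by simp⟩
    · rintro ⟨e, f, hef, he, hf⟩
      by_contra hp
      have hppos := List.length_pos_iff.mpr hp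
      have ha : (v ++ p) ++ [a] ∈ LangS σ := by
        refine langS_infix σ ?_ hr.1
        rw [hrp]; exact ⟨[], r', by simp⟩
      have hb : (v ++ p) ++ [b] ∈ LangS σ := by
        refine langS_infix σ ?_ hs.1
        rw [hsp]; exact ⟨[], s', by simp⟩
      have hsuf : v <:+ v ++ p := by
        by_contra hns
        have hns2 : ¬ (v ++ p) <:+ v := by
          intro h
          have := h.length_le
          simp only [List.length_append] at this
          omega
        obtain ⟨z, c, d, hcd, hz1, hz2⟩ := split_of_not_suffix hns hns2
        have ext : ∀ (m n : List A) (g : A), m <:+ n → n ++ [g] ∈ LangS σ → m ++ [g] ∈ LangS σ := by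
          rintro m n g ⟨l, rfl⟩ h
          exact langS_infix σ ⟨l, [], by simp⟩ h
        refine no_bad (LangS σ) (fun x y h hy => langS_infix σ h hy) u hu π
          (langS_sub hA u π w hσhom hσ hne hprim) _ z le_rfl
          ⟨c, d, e, f, a, b, hcd, hef, hab, ?_, ?_, ?_, ?_⟩
        · exact ext _ _ _ hz1 he
        · exact ext _ _ _ hz1 hf
        · exact ext _ _ _ hz2 ha
        · exact ext _ _ _ hz2 hb
      obtain ⟨t, ht⟩ := hsuf
      refine hr.2.2 ⟨t, a :: r', ?_, by simp, ?_⟩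
      · rintro rfl
        simp at ht
        exact hp ht
      · rw [ht, hrp]; simp
  rw [hsum, hg, ← hiff]
  have hpos : 0 < Fintype.card A - 1 := by omega
  refine ⟨Nat.mul_le_mul_left _ (by omega), ?_⟩
  rw [Nat.mul_right_inj hpos.ne']
  constructor
  · intro h
    have := length_psiW u (p.map π)
    simp only [List.length_map] at this
    exact List.length_eq_zero_iff.mp (by omega)
  · rintro rfl
    simp [psiW_nil]
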